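/- Let X = ℝ^d, let C ⊆ ℝ^d be a cone with nonempty interior, and let F₀ : ℝ^d → ℝ^d be a C¹ map such that for every x the derivative DF₀(x) is strongly positive (DF₀(x)v ≫ 0 whenever v > 0). Assume F₀ is pointwise dissipative. Then the set S₀ := {x ∈ ℝ^d : λ_max(x,F₀) > 0} has Lebesgue measure zero in ℝ^d; in particular F₀ has no observable chaos. -/

import Mathlib

open Filter Topology MeasureTheory Set Bornology Metric
open scoped ENNReal NNReal

noncomputable section

section Defs

variable {X : Type*} [NormedAddCommGroup X] [NormedSpace ℝ X]

/-- A cone in a Banach space: a closed convex set with `r • C ⊆ C` for all `r > 0`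
and `C ∩ (-C) = {0}`. -/
def IsCone (C : Set X) : Prop :=
  IsClosed C ∧ Convex ℝ C ∧ (∀ r : ℝ, 0 < r → ∀ x ∈ C, r • x ∈ C) ∧ C ∩ (-C) = {0}

/-- `(X, C)` is strongly ordered: `C` is a cone with nonempty interior. -/
def StronglyOrderedCone (C : Set X) : Prop :=
  IsCone C ∧ (interior C).Nonempty

/-- `x < y` in the order induced by the cone `C`. -/
def coneLT (C : Set X) (x y : X) : Prop := y - x ∈ C \ {0}

/-- `x ≤ y` in the order induced by the cone `C`. -/
def coneLE (C : Set X) (x y : X) : Prop := y - x ∈ C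

/-- `x ≪ y` in the order induced by the cone `C`. -/
def coneLLT (C : Set X) (x y : X) : Prop := y - x ∈ interior C

/-- A bounded linear operator is strongly positive (w.r.t. the cone `C`) if
`T v ≫ 0` whenever `v > 0`. -/
def StronglyPositive (C : Set X) (T : X →L[ℝ] X) : Prop :=
  ∀ v : X, v ∈ C \ {0} → T v ∈ interior C

/-- A map between normed spaces is compact if it sends bounded sets to relatively
compact sets. -/
def IsCompactMap {Y Z : Type*} [NormedAddCommGroup Y] [NormedAddCommGroup Z]
    (f : Y → Z) : Prop :=
  ∀ B : Set Y, IsBounded B → IsCompact (closure (f '' B))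

/-- `h` is pointwise dissipative: some nonempty bounded set `B` attracts every point. -/
def PointwiseDissipative (h : X → X) : Prop :=
  ∃ B : Set X, B.Nonempty ∧ IsBounded B ∧
    ∀ x : X, Tendsto (fun n : ℕ => infDist (h^[n] x) B) atTop (nhds 0)

/-- The set `A` attracts the set `B` under iteration of `h`. -/
def AttractsSet (h : X → X) (A B : Set X) : Prop :=
  ∀ ε : ℝ, 0 < ε → ∃ N : ℕ, ∀ n : ℕ, N ≤ n → ∀ x ∈ B, infDist (h^[n] x) A < ε

/-- `A` is an attractor of `h`: the maximal compact invariant set attracting every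
bounded set. -/
def IsAttractor (h : X → X) (A : Set X) : Prop :=
  A.Nonempty ∧ IsCompact A ∧ h '' A = A ∧
    (∀ B : Set X, IsBounded B → AttractsSet h A B) ∧
    (∀ A' : Set X, IsCompact A' → h '' A' = A' → A' ⊆ A)

/-- The ω-limit set `ω(x,h) = ⋂ₖ closure {hⁿ x : n ≥ k}`. -/
def omegaMap (h : X → X) (x : X) : Set X :=
  ⋂ k : ℕ, closure {y : X | ∃ n : ℕ, k ≤ n ∧ y = h^[n] x}

/-- The largest Lyapunov exponent `λ_max(x,h) = liminf (log ‖Dhⁿ(x)‖)/n` (in `EReal`). -/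
def lambdaMax (h : X → X) (x : X) : EReal :=
  atTop.liminf fun n : ℕ => ((Real.log ‖fderiv ℝ (h^[n]) x‖ / n : ℝ) : EReal)

/-- The principal Lyapunov exponent `λ₁(x,h) = limsup (log ‖Dhⁿ(x)‖)/n` (in `EReal`). -/
def lambdaOne (h : X → X) (x : X) : EReal :=
  atTop.limsup fun n : ℕ => ((Real.log ‖fderiv ℝ (h^[n]) x‖ / n : ℝ) : EReal)

/-- `S` is a linearly stable cycle of `h` of minimal period `p`: `S` is the orbit of a
`p`-periodic point `z` with spectral radius of `Dhᵖ(z)` at most `1`. -/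
def IsLinStableCycle (h : X → X) (p : ℕ) (S : Set X) : Prop :=
  ∃ z : X, h^[p] z = z ∧ (∀ l : ℕ, 0 < l → l < p → h^[l] z ≠ z) ∧
    spectralRadius ℝ (fderiv ℝ (h^[p]) z) ≤ 1 ∧ S = {y : X | ∃ n : ℕ, y = h^[n] z}

/-- `S` is a linearly stable cycle of `h` of minimal period at most `m`. -/
def IsLinStableCycleLe (h : X → X) (m : ℕ) (S : Set X) : Prop :=
  ∃ p : ℕ, 0 < p ∧ p ≤ m ∧ IsLinStableCycle h p S

/-- Semiflow axioms for `Φ : ℝ → X → X` (restricted to nonnegative times). -/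
def IsSemiflow (Φ : ℝ → X → X) : Prop :=
  (∀ x : X, Φ 0 x = x) ∧
    (∀ s t : ℝ, 0 ≤ s → 0 ≤ t → ∀ x : X, Φ (t + s) x = Φ t (Φ s x)) ∧
    ContinuousOn (fun p : ℝ × X => Φ p.1 p.2) (Ici (0 : ℝ) ×ˢ (univ : Set X))

/-- The ω-limit set of `x` under a semiflow. -/
def omegaFlow (Φ : ℝ → X → X) (x : X) : Set X :=
  ⋂ s : ℝ, closure {y : X | ∃ t : ℝ, s ≤ t ∧ y = Φ t x}

/-- The largest Lyapunov exponent of `x` w.r.t. a semiflow. -/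
def lambdaMaxFlow (Φ : ℝ → X → X) (x : X) : EReal :=
  atTop.liminf fun t : ℝ => ((Real.log ‖fderiv ℝ (Φ t) x‖ / t : ℝ) : EReal)

/-- The principal Lyapunov exponent of `x` w.r.t. a semiflow. -/
def lambdaOneFlow (Φ : ℝ → X → X) (x : X) : EReal :=
  atTop.limsup fun t : ℝ => ((Real.log ‖fderiv ℝ (Φ t) x‖ / t : ℝ) : EReal)

end Defs

section Shy

variable {X : Type*} [NormedAddCommGroup X] [NormedSpace ℝ X] [MeasurableSpace X]

/-- A Borel set `W` is shy if there is a nonzero compactly supported Borel measure `μ`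
with `μ(x + W) = 0` for every `x`. -/
def IsShy (W : Set X) : Prop :=
  MeasurableSet W ∧
    ∃ μ : Measure X, μ ≠ 0 ∧ (∃ K : Set X, IsCompact K ∧ μ Kᶜ = 0) ∧
      ∀ x : X, μ ((fun w => x + w) '' W) = 0

/-- `W` is prevalent in `V` if `V \ W` is shy. -/
def IsPrevalentIn (V W : Set X) : Prop := IsShy (V \ W)

end Shy

section ConePositivity

variable {X : Type*} [NormedAddCommGroup X] [NormedSpace ℝ X] {C : Set X}

lemma IsCone.zero_mem (hC : IsCone C) : (0 : X) ∈ C := by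
  have h : (0 : X) ∈ C ∩ (-C) := by rw [hC.2.2.2]; rfl
  exact h.1

lemma IsCone.exists_functional_pos (hC : IsCone C) {c : X} (hc : c ∈ C) (hc0 : c ≠ 0) :
    ∃ φ : StrongDual ℝ X, (∀ x ∈ C, 0 ≤ φ x) ∧ 0 < φ c := by
  have hneg : -c ∉ C := fun h => hc0 (by
    have : c ∈ C ∩ (-C) := ⟨hc, h⟩
    rwa [hC.2.2.2] at this)
  obtain ⟨φ, u, hu, hφ⟩ := geometric_hahn_banach_point_closed hC.2.1 hC.1 hneg
  have hu0 : u < 0 := by simpa using hφ 0 hC.zero_mem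
  refine ⟨φ, fun x hx => ?_, ?_⟩
  · by_contra! hlt
    have h := hφ _ (hC.2.2.1 (u / φ x) (div_pos_of_neg_of_neg hu0 hlt) x hx)
    rw [map_smul, smul_eq_mul, div_mul_cancel₀ _ hlt.ne] at h
    exact lt_irrefl _ h
  · rw [map_neg] at hu
    linarith

/-- In finite dimension, a cone admits a functional bounding the norm on the cone. -/
lemma IsCone.exists_functional_norm_le [FiniteDimensional ℝ X] (hC : IsCone C) :
    ∃ φ : StrongDual ℝ X, ∀ x ∈ C, ‖x‖ ≤ φ x := by
  have hK : IsCompact (C ∩ sphere (0 : X) 1) := by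
    have := FiniteDimensional.proper ℝ X
    exact (isCompact_sphere _ _).inter_left hC.1
  obtain ⟨φ, hφ0, hφ⟩ : ∃ φ : StrongDual ℝ X, (∀ x ∈ C, 0 ≤ φ x) ∧
      ∀ x ∈ C ∩ sphere (0 : X) 1, 0 < φ x := by
    refine hK.induction_on
      (p := fun s => ∃ φ : StrongDual ℝ X, (∀ x ∈ C, 0 ≤ φ x) ∧ ∀ x ∈ C ∩ s, 0 < φ x)
      ?_ ?_ ?_ ?_ |>.imp fun φ h => ⟨h.1, fun x hx => h.2 x ⟨hx.1, hx⟩⟩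
    · exact ⟨0, by simp, by simp⟩
    · rintro s t hst ⟨φ, h0, h⟩
      exact ⟨φ, h0, fun x hx => h x ⟨hx.1, hst hx.2⟩⟩
    · rintro s t ⟨φ, h0, h⟩ ⟨ψ, h0', h'⟩
      refine ⟨φ + ψ, fun x hx => add_nonneg (h0 x hx) (h0' x hx), ?_⟩
      rintro x ⟨hx, hxs | hxt⟩
      · exact add_pos_of_pos_of_nonneg (h x ⟨hx, hxs⟩) (h0' x hx)
      · exact add_pos_of_nonneg_of_pos (h0 x hx) (h' x ⟨hx, hxt⟩)
    · rintro c ⟨hc, hc1⟩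
      obtain ⟨φ, h0, h⟩ := hC.exists_functional_pos hc (ne_zero_of_mem_unit_sphere ⟨c, hc1⟩)
      exact ⟨{x | 0 < φ x},
        mem_nhdsWithin_of_mem_nhds ((isOpen_lt continuous_const φ.continuous).mem_nhds h),
        φ, h0, fun x hx => hx.2⟩
  obtain ⟨m, hm, hφm⟩ : ∃ m : ℝ, 0 < m ∧ ∀ x ∈ C ∩ sphere (0 : X) 1, m ≤ φ x := by
    rcases (C ∩ sphere (0 : X) 1).eq_empty_or_nonempty with he | hne
    · exact ⟨1, one_pos, by simp [he]⟩
    · obtain ⟨y, hy, hmin⟩ := hK.exists_isMinOn hne φ.continuous.continuousOn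
      exact ⟨φ y, hφ y hy, fun x hx => hmin hx⟩
  refine ⟨m⁻¹ • φ, fun x hx => ?_⟩
  rcases eq_or_ne x 0 with rfl | hx0
  · simp
  have hn : 0 < ‖x‖ := norm_pos_iff.2 hx0
  have h := hφm (‖x‖⁻¹ • x) ⟨hC.2.2.1 _ (inv_pos.2 hn) x hx, by simp [norm_smul, hn.ne']⟩
  rw [map_smul, smul_eq_mul, inv_mul_eq_div, le_div_iff₀ hn] at h
  change ‖x‖ ≤ m⁻¹ * φ x
  rwa [inv_mul_eq_div, le_div_iff₀ hm, mul_comm]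

/-- The norm of a positive operator is controlled by its value at an interior point. -/
lemma exists_opNorm_le_of_mapsTo {φ : StrongDual ℝ X} (hφ : ∀ x ∈ C, ‖x‖ ≤ φ x)
    {v : X} (hv : v ∈ interior C) :
    ∃ K : ℝ, 0 < K ∧ ∀ T : X →L[ℝ] X, MapsTo T C C → ‖T‖ ≤ K * φ (T v) := by
  obtain ⟨r, hr, hball⟩ := Metric.mem_nhds_iff.1 (mem_interior_iff_mem_nhds.1 hv)
  refine ⟨(r / 2)⁻¹, by positivity, fun T hT => ?_⟩
  have hTv : 0 ≤ φ (T v) := (norm_nonneg _).trans (hφ _ (hT (interior_subset hv)))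
  have key : ∀ u : X, ‖u‖ < r → ‖T u‖ ≤ φ (T v) := by
    intro u hu
    have h1 := hφ _ (hT (hball (show v + u ∈ ball v r by simpa using hu)))
    have h2 := hφ _ (hT (hball (show v - u ∈ ball v r by simpa [dist_eq_norm] using hu)))
    have h3 := norm_sub_le (T (v + u)) (T (v - u))
    have h4 : T (v + u) - T (v - u) = (2 : ℝ) • T u := by
      rw [map_add, map_sub, two_smul]; abel
    rw [h4, norm_smul, Real.norm_ofNat] at h3
    simp only [map_add, map_sub] at h1 h2 h3
    linarith
  refine T.opNorm_le_bound (by positivity) fun x => ?_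
  rcases eq_or_ne x 0 with rfl | hx
  · simp
  have hn : 0 < ‖x‖ := norm_pos_iff.2 hx
  have h := key ((r / 2 / ‖x‖) • x) (by
    rw [norm_smul, Real.norm_of_nonneg (by positivity), div_mul_cancel₀ _ hn.ne']; linarith)
  rw [map_smul, norm_smul, Real.norm_of_nonneg (by positivity)] at h
  have h5 : ‖T x‖ = (r / 2)⁻¹ * ((r / 2 / ‖x‖) * ‖T x‖) * ‖x‖ := by
    field_simp
  rw [h5]
  gcongr

lemma ContDiff.iterate_self {h : X → X} (hh : ContDiff ℝ 1 h) (n : ℕ) :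
    ContDiff ℝ 1 (h^[n]) := by
  induction n with
  | zero => exact contDiff_id
  | succ n ih => rw [Function.iterate_succ']; exact hh.comp ih

lemma mapsTo_fderiv_iterate {h : X → X} (hC : IsCone C) (hh : ContDiff ℝ 1 h)
    (hpos : ∀ x, StronglyPositive C (fderiv ℝ h x)) (n : ℕ) (x : X) :
    MapsTo (fderiv ℝ (h^[n]) x) C C := by
  induction n with
  | zero => intro u hu; simpa using hu
  | succ n ih =>
    intro u hu
    rw [Function.iterate_succ', fderiv_comp x (hh.differentiable one_ne_zero _)
      ((hh.iterate_self n).differentiable one_ne_zero _)]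
    have hw := ih hu
    change fderiv ℝ h (h^[n] x) (fderiv ℝ (h^[n]) x u) ∈ C
    by_cases h0 : fderiv ℝ (h^[n]) x u = 0
    · rw [h0, map_zero]; exact hC.zero_mem
    · exact interior_subset (hpos _ _ ⟨hw, h0⟩)

lemma PointwiseDissipative.exists_norm_iterate_le {Y : Type*} [NormedAddCommGroup Y]
    {h : Y → Y} (hd : PointwiseDissipative h) (x : Y) : ∃ R : ℝ, ∀ n : ℕ, ‖h^[n] x‖ ≤ R := by
  obtain ⟨B, hne, hB, hlim⟩ := hd
  obtain ⟨M, hM⟩ := hB.exists_norm_le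
  obtain ⟨D, hD⟩ := (hlim x).bddAbove_range
  refine ⟨D + 1 + M, fun n => ?_⟩
  have hDn : infDist (h^[n] x) B ≤ D := hD ⟨n, rfl⟩
  obtain ⟨b, hb, hdist⟩ := (infDist_lt_iff hne).1 (hDn.trans_lt (lt_add_one D))
  have := hM b hb
  have h2 := norm_le_norm_add_norm_sub' (h^[n] x) b
  rw [dist_eq_norm] at hdist
  linarith

/-- A finite lower limit of `‖Dhⁿ(x)‖` excludes a positive exponent. -/
lemma lambdaMax_nonpos_of_liminf_lt_top {h : X → X} {x : X}
    (hx : liminf (fun n : ℕ => ‖fderiv ℝ (h^[n]) x‖ₑ) atTop < ∞) : lambdaMax h x ≤ 0 := by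
  by_contra! hlt
  obtain ⟨ε, hε0, hε⟩ := EReal.lt_iff_exists_real_btwn.1 hlt
  have hε0 : 0 < ε := by exact_mod_cast hε0
  obtain ⟨K, hK, hKtop⟩ := exists_between hx
  lift K to ℝ≥0 using hKtop.ne
  have hfreq : ∃ᶠ n : ℕ in atTop, ‖fderiv ℝ (h^[n]) x‖ₑ < K :=
    frequently_lt_of_liminf_lt (by isBoundedDefault) hK
  have hev : ∀ᶠ n : ℕ in atTop,
      (ε : EReal) < ((Real.log ‖fderiv ℝ (h^[n]) x‖ / n : ℝ) : EReal) :=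
    eventually_lt_of_lt_liminf hε
  obtain ⟨N, hN⟩ := exists_nat_gt (Real.log (max K 1) / ε)
  obtain ⟨n, hnK, hnε, hnN, hn0⟩ := (hfreq.and_eventually
    (hev.and ((eventually_ge_atTop N).and (eventually_gt_atTop 0)))).exists
  have hnε : ε < Real.log ‖fderiv ℝ (h^[n]) x‖ / n := by exact_mod_cast hnε
  have hnK : ‖fderiv ℝ (h^[n]) x‖ ≤ max (K : ℝ) 1 := by
    refine le_max_of_le_left ?_
    rw [enorm_eq_nnnorm, ENNReal.coe_lt_coe] at hnK
    exact_mod_cast hnK.le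
  have hlog : Real.log ‖fderiv ℝ (h^[n]) x‖ ≤ Real.log (max K 1) := by
    rcases (norm_nonneg (fderiv ℝ (h^[n]) x)).eq_or_lt with h0 | h0
    · rw [← h0, Real.log_zero]
      exact Real.log_nonneg (le_max_right _ _)
    · exact Real.log_le_log h0 hnK
  have hn0 : (0 : ℝ) < n := by exact_mod_cast hn0
  have hnN : (N : ℝ) ≤ n := by exact_mod_cast hnN
  rw [lt_div_iff₀ hn0] at hnε
  rw [div_lt_iff₀ hε0] at hN
  nlinarith

lemma measurable_lambdaMax [MeasurableSpace X] [BorelSpace X] {h : X → X}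
    (hh : ContDiff ℝ 1 h) : Measurable (lambdaMax h) := by
  refine Measurable.liminf fun n => measurable_coe_real_ereal.comp ?_
  have hc : Continuous fun x => ‖fderiv ℝ (h^[n]) x‖ :=
    ((hh.iterate_self n).continuous_fderiv one_ne_zero).norm
  exact (Real.measurable_log.comp hc.measurable).div_const _

/-- The norms of the derivatives of the iterates have uniformly bounded integrals over a segment
in an interior direction of the cone. -/
lemma exists_lintegral_enorm_fderiv_iterate_le [FiniteDimensional ℝ X] {h : X → X}
    (hC : IsCone C) (hh : ContDiff ℝ 1 h) (hpos : ∀ x, StronglyPositive C (fderiv ℝ h x))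
    (hd : PointwiseDissipative h) {v : X} (hv : v ∈ interior C) (x : X) {a b : ℝ} (hab : a ≤ b) :
    ∃ R : ℝ, ∀ n : ℕ,
      ∫⁻ t in Ioc a b, ‖fderiv ℝ (h^[n]) (x + t • v)‖ₑ ≤ ENNReal.ofReal R := by
  obtain ⟨φ, hφ⟩ := hC.exists_functional_norm_le
  obtain ⟨K, hK, hT⟩ := exists_opNorm_le_of_mapsTo hφ hv
  obtain ⟨Ra, hRa⟩ := hd.exists_norm_iterate_le (x + a • v)
  obtain ⟨Rb, hRb⟩ := hd.exists_norm_iterate_le (x + b • v)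
  refine ⟨K * (‖φ‖ * (Rb + Ra)), fun n => ?_⟩
  have hn := hh.iterate_self n
  set g : ℝ → ℝ := fun t => φ (fderiv ℝ (h^[n]) (x + t • v) v) with hg
  have hgc : Continuous g := by
    have h1 := hn.continuous_fderiv one_ne_zero
    exact φ.continuous.comp ((h1.comp (by fun_prop)).clm_apply continuous_const)
  have hg0 : ∀ t, 0 ≤ g t := fun t => (norm_nonneg _).trans
    (hφ _ (mapsTo_fderiv_iterate hC hh hpos n _ (interior_subset hv)))
  have hderiv : ∀ t ∈ uIcc a b, HasDerivAt (fun t : ℝ => φ (h^[n] (x + t • v))) (g t) t := by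
    intro t _
    have h1 : HasDerivAt (fun t : ℝ => x + t • v) v t := by
      simpa using ((hasDerivAt_id t).smul_const v).const_add x
    have h2 := (hn.differentiable one_ne_zero (x + t • v)).hasFDerivAt
    exact φ.hasFDerivAt.comp_hasDerivAt t (h2.comp_hasDerivAt t h1)
  have hint := intervalIntegral.integral_eq_sub_of_hasDerivAt hderiv
    (hgc.intervalIntegrable a b)
  rw [intervalIntegral.integral_of_le hab, ← map_sub] at hint
  have hgi : Integrable g (volume.restrict (Ioc a b)) := (hgc.intervalIntegrable a b).1
  calc ∫⁻ t in Ioc a b, ‖fderiv ℝ (h^[n]) (x + t • v)‖ₑ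
      ≤ ∫⁻ t in Ioc a b, ENNReal.ofReal (K * g t) := by
        refine lintegral_mono fun t => ?_
        rw [← ofReal_norm]
        exact ENNReal.ofReal_le_ofReal (hT _ (mapsTo_fderiv_iterate hC hh hpos n _))
    _ = ENNReal.ofReal (∫ t in Ioc a b, K * g t) :=
        (ofReal_integral_eq_lintegral_ofReal (hgi.const_mul K)
          (.of_forall fun t => mul_nonneg hK.le (hg0 t))).symm
    _ ≤ ENNReal.ofReal (K * (‖φ‖ * (Rb + Ra))) := by
        rw [integral_const_mul, hint]
        gcongr
        refine (le_abs_self _).trans ((φ.le_opNorm _).trans ?_)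
        gcongr
        exact (norm_sub_le _ _).trans (add_le_add (hRb n) (hRa n))

lemma ae_lambdaMax_nonpos_on_line [FiniteDimensional ℝ X] {h : X → X}
    (hC : IsCone C) (hh : ContDiff ℝ 1 h) (hpos : ∀ x, StronglyPositive C (fderiv ℝ h x))
    (hd : PointwiseDissipative h) {v : X} (hv : v ∈ interior C) (x : X) :
    ∀ᵐ t : ℝ, lambdaMax h (x + t • v) ≤ 0 := by
  have hU : (⋃ m : ℕ, Ioc (-(m : ℝ)) m) = univ := by
    refine eq_univ_of_forall fun t => mem_iUnion.2 ?_
    obtain ⟨m, hm⟩ := exists_nat_gt |t|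
    exact ⟨m, (abs_lt.1 hm).1, (abs_lt.1 hm).2.le⟩
  rw [← Measure.restrict_univ (μ := (volume : Measure ℝ)), ← hU, ae_restrict_iUnion_iff]
  intro m
  have hm : -(m : ℝ) ≤ m := by linarith [m.cast_nonneg (α := ℝ)]
  obtain ⟨R, hR⟩ := exists_lintegral_enorm_fderiv_iterate_le hC hh hpos hd hv x hm
  have hmeas : ∀ n : ℕ, Measurable fun t : ℝ => ‖fderiv ℝ (h^[n]) (x + t • v)‖ₑ := fun n =>
    (((hh.iterate_self n).continuous_fderiv one_ne_zero).comp
      (by fun_prop : Continuous fun t : ℝ => x + t • v)).enorm.measurable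
  have hfin : ∫⁻ t in Ioc (-(m : ℝ)) m,
      liminf (fun n : ℕ => ‖fderiv ℝ (h^[n]) (x + t • v)‖ₑ) atTop ≠ ∞ := by
    refine ne_top_of_le_ne_top (ENNReal.ofReal_ne_top (r := R))
      ((lintegral_liminf_le hmeas).trans ?_)
    exact liminf_le_of_frequently_le' (Frequently.of_forall hR)
  filter_upwards [ae_lt_top (Measurable.liminf hmeas) hfin] with t ht
  exact lambdaMax_nonpos_of_liminf_lt_top ht

end ConePositivity

/-- **Theorem A**, finite-dimensional form: in `ℝ^d`, the set where the largest
Lyapunov exponent is positive has Lebesgue measure zero; in particular `F₀` has no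
observable chaos. -/
theorem no_observable_chaos_monotone_maps_Rd
    {d : ℕ} (C : Set (EuclideanSpace ℝ (Fin d))) (hC : StronglyOrderedCone C)
    (F₀ : EuclideanSpace ℝ (Fin d) → EuclideanSpace ℝ (Fin d))
    (hC1 : ContDiff ℝ 1 F₀)
    (hpos : ∀ x : EuclideanSpace ℝ (Fin d), StronglyPositive C (fderiv ℝ F₀ x))
    (hdiss : PointwiseDissipative F₀) :
    volume {x : EuclideanSpace ℝ (Fin d) | 0 < lambdaMax F₀ x} = 0 ∧
      ¬ ∃ E : Set (EuclideanSpace ℝ (Fin d)),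
          MeasurableSet E ∧ 0 < volume E ∧ ∀ x ∈ E, 0 < lambdaMax F₀ x := by
  have hae : ∀ᵐ x : EuclideanSpace ℝ (Fin d), x ∈ {x | lambdaMax F₀ x ≤ 0} := by
    obtain ⟨v, hv⟩ := hC.2
    refine ae_mem_of_ae_add_linearMap_mem (LinearMap.toSpanSingleton ℝ _ v) volume volume
      (measurableSet_le (measurable_lambdaMax hC1) measurable_const) fun x => ?_
    exact ae_lambdaMax_nonpos_on_line hC.1 hC1 hpos hdiss hv x
  have hnull : volume {x : EuclideanSpace ℝ (Fin d) | 0 < lambdaMax F₀ x} = 0 := by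
    simpa [ae_iff] using hae
  refine ⟨hnull, ?_⟩
  rintro ⟨E, -, hE, hpos⟩
  exact hE.ne' (measure_mono_null hpos hnull)

end
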